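/- Fix p ∈ (0,1] and for each n ≥ 3 fix three distinct vertices s, a, b of ⃗G(n,p). Then P(s↛a and b↛s) = 3(1 − p/2)^{2n−3} + o((1−p/2)^{2n}) as n → ∞. -/

import Mathlib

open Filter Real

/-- Edges of the complete graph on `Fin n`: ordered pairs `(u,v)` with `u < v`. -/
abbrev Edge (n : ℕ) : Type := {e : Fin n × Fin n // e.1 < e.2}

/-- A configuration of the random edge-orientation model: for each pair `u < v`,
`none` means no edge, `some true` means the directed edge `u → v`, and
`some false` means the directed edge `v → u`. -/
abbrev Config (n : ℕ) : Type := Edge n → Option Bool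

/-- The directed edge relation determined by a configuration. -/
def DirEdge {n : ℕ} (f : Config n) (u v : Fin n) : Prop :=
  (∃ h : u < v, f ⟨(u, v), h⟩ = some true) ∨ (∃ h : v < u, f ⟨(v, u), h⟩ = some false)

/-- `Reaches f u v`: the configuration `f` contains a directed path from `u` to `v`
(paths of length `0` are allowed, so `Reaches f u u` always holds). -/
def Reaches {n : ℕ} (f : Config n) (u v : Fin n) : Prop :=
  Relation.ReflTransGen (DirEdge f) u v

/-- The probability of an event under a weight function on a finite sample space. -/
noncomputable def prWeight {α : Type*} [Fintype α] (w : α → ℝ) (E : Set α) : ℝ :=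
  ∑ x, E.indicator w x

/-- The weight of one edge state in `⃗G(n,p)`: no edge has probability `1 - p`
and each of the two orientations has probability `p/2`. -/
noncomputable def edgeWeight (p : ℝ) : Option Bool → ℝ
  | none => 1 - p
  | some _ => p / 2

/-- The probability of an event in the random directed graph `⃗G(n,p)`. -/
noncomputable def PrGnp (n : ℕ) (p : ℝ) (E : Set (Config n)) : ℝ :=
  prWeight (fun f => ∏ e : Edge n, edgeWeight p (f e)) E

/-- The number of present edges of a configuration. -/
def edgeCount {n : ℕ} (f : Config n) : ℕ :=
  (Finset.univ.filter fun e : Edge n => (f e).isSome).card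

/-- The probability of an event in the random directed graph `⃗G(n,m)`:
the underlying graph is uniform among the graphs with exactly `m` edges, and each
present edge is oriented in one of its two directions with probability `1/2`,
independently over edges. -/
noncomputable def PrGnm (n m : ℕ) (E : Set (Config n)) : ℝ :=
  prWeight (fun f => if edgeCount f = m
      then ((Nat.choose (Nat.choose n 2) m : ℝ) * 2 ^ m)⁻¹ else 0) E

section Weights

variable {α : Type*} [Fintype α] {w : α → ℝ}

lemma prWeight_mono (hw : ∀ x, 0 ≤ w x) {E F : Set α} (h : E ⊆ F) :
    prWeight w E ≤ prWeight w F :=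
  Finset.sum_le_sum fun x _ => Set.indicator_le_indicator_of_subset h hw x

lemma prWeight_union_le (hw : ∀ x, 0 ≤ w x) (E F : Set α) :
    prWeight w (E ∪ F) ≤ prWeight w E + prWeight w F := by
  classical
  unfold prWeight
  rw [← Finset.sum_add_distrib]
  refine Finset.sum_le_sum fun x _ => ?_
  have := hw x
  by_cases h1 : x ∈ E <;> by_cases h2 : x ∈ F <;> simp [h1, h2, this]

lemma prWeight_exists_le (hw : ∀ x, 0 ≤ w x) {ι : Type*} (I : Finset ι) (S : ι → Set α) :
    prWeight w {x | ∃ i ∈ I, x ∈ S i} ≤ ∑ i ∈ I, prWeight w (S i) := by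
  classical
  unfold prWeight
  rw [Finset.sum_comm]
  refine Finset.sum_le_sum fun x _ => ?_
  by_cases h : ∃ i ∈ I, x ∈ S i
  · obtain ⟨i, hi, hx⟩ := h
    rw [Set.indicator_of_mem (show x ∈ {x | ∃ i ∈ I, x ∈ S i} from ⟨i, hi, hx⟩)]
    calc w x = (S i).indicator w x := (Set.indicator_of_mem hx w).symm
      _ ≤ _ := Finset.single_le_sum (f := fun i => (S i).indicator w x)
          (fun j _ => Set.indicator_nonneg (fun y _ => hw y) x) hi
  · rw [Set.indicator_of_notMem (show x ∉ {x | ∃ i ∈ I, x ∈ S i} from h)]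
    exact Finset.sum_nonneg fun j _ => Set.indicator_nonneg (fun y _ => hw y) x

/-- Bonferroni's inequality for three events contained in a fourth one. -/
lemma prWeight_bonferroni (hw : ∀ x, 0 ≤ w x) {E E₁ E₂ E₃ : Set α}
    (h₁ : E₁ ⊆ E) (h₂ : E₂ ⊆ E) (h₃ : E₃ ⊆ E) :
    prWeight w E₁ + prWeight w E₂ + prWeight w E₃ ≤
      prWeight w E + prWeight w (E₁ ∩ E₂) + prWeight w (E₁ ∩ E₃) + prWeight w (E₂ ∩ E₃) := by
  classical
  unfold prWeight
  simp only [← Finset.sum_add_distrib]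
  refine Finset.sum_le_sum fun x _ => ?_
  have := hw x
  have m₁ := @h₁ x
  have m₂ := @h₂ x
  have m₃ := @h₃ x
  by_cases c₁ : x ∈ E₁ <;> by_cases c₂ : x ∈ E₂ <;> by_cases c₃ : x ∈ E₃ <;>
    by_cases c : x ∈ E <;> simp_all

end Weights

lemma edgeWeight_nonneg {p : ℝ} (h0 : 0 ≤ p) (h1 : p ≤ 1) (x : Option Bool) :
    0 ≤ edgeWeight p x := by
  cases x <;> simp only [edgeWeight] <;> linarith

lemma configWeight_nonneg {n : ℕ} {p : ℝ} (h0 : 0 ≤ p) (h1 : p ≤ 1) (f : Config n) :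
    0 ≤ ∏ e : Edge n, edgeWeight p (f e) :=
  Finset.prod_nonneg fun _ _ => edgeWeight_nonneg h0 h1 _

/-- The event that none of the directed edges in `D` is present. -/
def avoid {n : ℕ} (D : Finset (Fin n × Fin n)) : Set (Config n) :=
  {f | ∀ d ∈ D, ¬ DirEdge f d.1 d.2}

lemma avoid_anti {n : ℕ} {D D' : Finset (Fin n × Fin n)} (h : D ⊆ D') : avoid D' ⊆ avoid D :=
  fun _ hf d hd => hf d (h hd)

lemma avoid_inter {n : ℕ} (D D' : Finset (Fin n × Fin n)) :
    avoid D ∩ avoid D' = avoid (D ∪ D') := by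
  ext f
  simp only [avoid, Set.mem_inter_iff, Set.mem_ofPred_eq, Finset.mem_union]
  exact ⟨fun h d hd => hd.elim (h.1 d) (h.2 d), fun h => ⟨fun d hd => h d (.inl hd),
    fun d hd => h d (.inr hd)⟩⟩

lemma mem_avoid_iff {n : ℕ} (D : Finset (Fin n × Fin n)) (f : Config n) :
    f ∈ avoid D ↔ ∀ e : Edge n, (f e = some true → e.1 ∉ D) ∧
      (f e = some false → e.1.swap ∉ D) := by
  constructor
  · rintro h ⟨⟨u, v⟩, huv⟩
    exact ⟨fun hf hD => h _ hD (.inl ⟨huv, hf⟩), fun hf hD => h _ hD (.inr ⟨huv, hf⟩)⟩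
  · rintro h ⟨u, v⟩ hD (⟨huv, hf⟩ | ⟨huv, hf⟩)
    · exact (h _).1 hf hD
    · exact (h _).2 hf hD

lemma PrGnp_avoid {n : ℕ} (p : ℝ) (D : Finset (Fin n × Fin n)) :
    PrGnp n p (avoid D) = ∏ e : Edge n,
      (1 - p / 2 * ((if e.1 ∈ D then 1 else 0) + (if e.1.swap ∈ D then 1 else 0))) := by
  classical
  have key : ∀ e : Edge n,
      (1 - p / 2 * ((if e.1 ∈ D then 1 else 0) + (if e.1.swap ∈ D then 1 else 0))) =
      ∑ x : Option Bool, if (x = some true → e.1 ∉ D) ∧ (x = some false → e.1.swap ∉ D)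
        then edgeWeight p x else 0 := by
    intro e
    rw [Fintype.sum_option, Fintype.sum_bool]
    by_cases h1 : e.1 ∈ D <;> by_cases h2 : e.1.swap ∈ D <;>
      simp [h1, h2, edgeWeight] <;> ring
  rw [Finset.prod_congr rfl fun e _ => key e, Finset.prod_univ_sum, Fintype.piFinset_univ]
  unfold PrGnp prWeight
  refine Finset.sum_congr rfl fun f _ => ?_
  rw [Finset.prod_ite_zero]
  by_cases h : f ∈ avoid D
  · rw [Set.indicator_of_mem h, if_pos]
    exact fun e _ => (mem_avoid_iff D f).1 h e
  · rw [Set.indicator_of_notMem h, if_neg]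
    exact fun h' => h ((mem_avoid_iff D f).2 fun e => h' e (Finset.mem_univ e))

lemma prod_edge_pow {n : ℕ} (t : ℝ) (D : Finset (Fin n × Fin n)) (hD : ∀ d ∈ D, d.1 ≠ d.2) :
    ∏ e : Edge n, t ^ ((if e.1 ∈ D then 1 else 0) + (if e.1.swap ∈ D then 1 else 0)) =
      t ^ D.card := by
  classical
  rw [Finset.prod_pow_eq_pow_sum, Finset.sum_add_distrib]
  congr 1
  rw [← Finset.card_filter_add_card_filter_not (s := D) (fun d => d.1 < d.2)]
  congr 1
  · rw [← Finset.card_filter]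
    refine Finset.card_bij (fun e _ => e.1) ?_ ?_ ?_
    · intro e he
      simpa [e.2] using he
    · intro e _ e' _ h
      exact Subtype.ext h
    · intro d hd
      rw [Finset.mem_filter] at hd
      exact ⟨⟨d, hd.2⟩, by simpa using hd.1, rfl⟩
  · rw [← Finset.card_filter]
    refine Finset.card_bij (fun e _ => e.1.swap) ?_ ?_ ?_
    · intro e he
      simpa [e.2.le] using he
    · intro e _ e' _ h
      exact Subtype.ext (Prod.swap_injective h)
    · intro d hd
      rw [Finset.mem_filter] at hd
      exact ⟨⟨d.swap, lt_of_le_of_ne (not_lt.1 hd.2) (hD d hd.1).symm⟩,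
        by simpa using hd.1, by simp⟩

lemma PrGnp_avoid_le {n : ℕ} {p : ℝ} (h0 : 0 ≤ p) (h1 : p ≤ 1) (D : Finset (Fin n × Fin n))
    (hD : ∀ d ∈ D, d.1 ≠ d.2) : PrGnp n p (avoid D) ≤ (1 - p / 2) ^ D.card := by
  rw [PrGnp_avoid, ← prod_edge_pow _ D hD]
  refine Finset.prod_le_prod (fun e _ => ?_) fun e _ => ?_ <;> split_ifs <;> norm_num <;>
    nlinarith

lemma PrGnp_avoid_eq {n : ℕ} (p : ℝ) (D : Finset (Fin n × Fin n))
    (hD : ∀ d ∈ D, d.1 ≠ d.2) (hD' : ∀ d ∈ D, d.swap ∉ D) :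
    PrGnp n p (avoid D) = (1 - p / 2) ^ D.card := by
  rw [PrGnp_avoid, ← prod_edge_pow _ D hD]
  refine Finset.prod_congr rfl fun e _ => ?_
  by_cases h : e.1 ∈ D
  · simp [h, hD' _ h]
  · by_cases h' : e.1.swap ∈ D <;> simp [h, h']

lemma PrGnp_isolated_le {n : ℕ} {p : ℝ} (h1 : p ≤ 1) (u : Fin n) (T : Finset (Fin n))
    (hu : u ∉ T) :
    PrGnp n p (avoid (({u} ×ˢ T) ∪ (T ×ˢ {u}))) ≤ (1 - p) ^ T.card := by
  have hc : T.card = (({u} : Finset (Fin n)) ×ˢ T).card := by simp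
  rw [PrGnp_avoid, hc, ← prod_edge_pow]
  · refine Finset.prod_le_prod (fun e _ => ?_) fun e _ => ?_
    · split_ifs <;> linarith
    · obtain ⟨⟨v, w⟩, he⟩ := e
      have hvw : v ≠ w := ne_of_lt he
      by_cases h1 : u = v <;> by_cases h2 : u = w <;> by_cases h3 : v ∈ T <;>
        by_cases h4 : w ∈ T <;> simp_all <;> linarith
  · rintro ⟨v, w⟩ h
    simp only [Finset.mem_product, Finset.mem_singleton] at h
    intro hvw
    exact hu (h.1 ▸ (show v = w from hvw) ▸ h.2)

lemma not_reaches_of_closed {n : ℕ} {f : Config n} (S : Set (Fin n)) {u v : Fin n}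
    (hS : ∀ x ∈ S, ∀ y, DirEdge f x y → y ∈ S) (hu : u ∈ S) (hv : v ∉ S) : ¬ Reaches f u v := by
  intro h
  refine hv ?_
  clear hv
  induction h with
  | refl => exact hu
  | tail _ hxy ih => exact hS _ ih _ hxy

section Colorings

variable {n : ℕ} {α : Type*}

/-- The pairs along which the coloring `c` fails to be monotone. -/
def nonmonoPairs [PartialOrder α] [DecidableLE α] (c : Fin n → α) : Finset (Fin n × Fin n) :=
  Finset.univ.filter fun d => ¬ c d.1 ≤ c d.2

lemma card_mul_card_le_nonmonoPairs [PartialOrder α] [DecidableLE α] [DecidableEq α]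
    (c : Fin n → α) (γ : α) :
    (Finset.univ.filter fun v => c v = γ).card * (Finset.univ.filter fun v => c v ≠ γ).card ≤
      (nonmonoPairs c).card := by
  rw [← Finset.card_product]
  refine Finset.card_le_card_of_injOn
    (fun d => if c d.1 ≤ c d.2 then d.swap else d) ?_ ?_
  · rintro ⟨u, v⟩ h
    simp only [Finset.coe_product, Set.mem_prod, Finset.mem_coe, Finset.mem_filter,
      Finset.mem_univ, true_and] at h
    simp only [nonmonoPairs, Finset.coe_filter, Finset.mem_univ, true_and, Set.mem_ofPred_eq]
    split_ifs with h'
    · exact fun h'' => h.2 ((le_antisymm h' h'').symm.trans h.1)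
    · exact h'
  · rintro ⟨u, v⟩ h ⟨u', v'⟩ h' heq
    simp only [Finset.coe_product, Set.mem_prod, Finset.mem_coe, Finset.mem_filter,
      Finset.mem_univ, true_and] at h h'
    dsimp only at heq
    split_ifs at heq <;> simp only [Prod.swap_prod_mk, Prod.mk.injEq] at heq ⊢ <;> grind

lemma sum_pow_card_ne [Fintype α] [DecidableEq α] (t : ℝ) (γ : α) :
    ∑ c : Fin n → α, t ^ (Finset.univ.filter fun v => c v ≠ γ).card =
      (1 + (Fintype.card α - 1) * t) ^ n := by
  have h1 : ∀ c : Fin n → α, t ^ (Finset.univ.filter fun v => c v ≠ γ).card =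
      ∏ v, (fun x => if x = γ then 1 else t) (c v) := by
    intro c
    rw [Finset.prod_ite]
    simp
  have h2 : ∑ x : α, (if x = γ then 1 else t) = 1 + (Fintype.card α - 1) * t := by
    have : ∀ x : α, (if x = γ then 1 else t) = (if x = γ then 1 - t else 0) + t := by
      intro x; split_ifs <;> ring
    simp only [this, Finset.sum_add_distrib, Finset.sum_ite_eq',
      Finset.mem_univ, if_true, Finset.sum_const, Finset.card_univ, nsmul_eq_mul]
    ring
  rw [Finset.sum_congr rfl fun c _ => h1 c, ← h2, ← Fintype.piFinset_univ,
    ← Finset.prod_univ_sum (fun _ => Finset.univ) fun _ x => if x = γ then 1 else t]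
  simp

end Colorings

lemma pow_mul_le_of_balanced {q : ℝ} (h0 : 0 < q) (h1 : q ≤ 1) {N m k : ℕ} (hN : 1 ≤ N)
    (hmk : m + k = N) (hk : 3 ≤ k) (hm : N ≤ 4 * m) (hq : N * q ^ m ≤ 1) :
    q ^ (m * k) ≤ N ^ 12 * q ^ (3 * N) / q ^ 36 * (1 / N : ℝ) ^ k := by
  have hN' : (1 : ℝ) ≤ N := by exact_mod_cast hN
  have hpos : (0 : ℝ) < N := by linarith
  suffices h : (N * q ^ m : ℝ) ^ k ≤ N ^ 12 * q ^ (3 * N) / q ^ 36 by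
    rw [div_pow, one_pow, mul_one_div, le_div_iff₀ (by positivity)]
    calc q ^ (m * k) * N ^ k = (N * q ^ m : ℝ) ^ k := by rw [mul_pow, pow_mul]; ring
      _ ≤ _ := h
  rw [le_div_iff₀ (by positivity)]
  rcases le_total k 12 with h | h
  · calc (N * q ^ m : ℝ) ^ k * q ^ 36 = N ^ k * q ^ (m * k + 36) := by
          rw [mul_pow, pow_add, pow_mul]; ring
      _ ≤ N ^ 12 * q ^ (3 * N) := by
          gcongr ?_ * ?_
          · exact pow_le_pow_right₀ hN' h
          · exact pow_le_pow_of_le_one h0.le h1 (by nlinarith)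
  · calc (N * q ^ m : ℝ) ^ k * q ^ 36 ≤ (N * q ^ m : ℝ) ^ 12 * q ^ 36 := by
          gcongr ?_ * _
          exact pow_le_pow_of_le_one (by positivity) hq h
      _ = N ^ 12 * q ^ (12 * m + 36) := by
          rw [mul_pow, pow_add, ← pow_mul]; ring
      _ ≤ N ^ 12 * q ^ (3 * N) := by
          gcongr ?_ * ?_
          exact pow_le_pow_of_le_one h0.le h1 (by omega)

/-- The colorings with a popular color `γ` that is nevertheless missed by three vertices. -/
def balancedColorings (n : ℕ) : Finset ((Bool × Bool) × (Fin n → Bool × Bool)) :=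
  Finset.univ.filter fun i => 3 ≤ (Finset.univ.filter fun v => i.2 v ≠ i.1).card ∧
    n ≤ 4 * (Finset.univ.filter fun v => i.2 v = i.1).card

lemma PrGnp_balanced_le {N : ℕ} {p : ℝ} (h0 : 0 ≤ p) (h1 : p ≤ 1) (hN : 1 ≤ N)
    (hq : ∀ m, N ≤ 4 * m → N * (1 - p / 2) ^ m ≤ 1) :
    PrGnp N p {f | ∃ i ∈ balancedColorings N, f ∈ avoid (nonmonoPairs i.2)} ≤
      4 * (N ^ 12 * (1 - p / 2) ^ (3 * N) / (1 - p / 2) ^ 36 * Real.exp 3) := by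
  have hpos : (0 : ℝ) < N := by exact_mod_cast hN
  have q0 : 0 < 1 - p / 2 := by linarith
  have q1 : 1 - p / 2 ≤ 1 := by linarith
  set M := N ^ 12 * (1 - p / 2) ^ (3 * N) / (1 - p / 2) ^ 36 with hM
  have hM0 : 0 ≤ M := by positivity
  calc _ ≤ ∑ i ∈ balancedColorings N, PrGnp N p (avoid (nonmonoPairs i.2)) :=
        prWeight_exists_le (configWeight_nonneg h0 h1) _ _
    _ ≤ ∑ i ∈ balancedColorings N,
          M * (1 / N : ℝ) ^ (Finset.univ.filter fun v => i.2 v ≠ i.1).card := by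
        refine Finset.sum_le_sum fun i hi => ?_
        rw [balancedColorings, Finset.mem_filter] at hi
        refine (PrGnp_avoid_le h0 h1 _ ?_).trans ?_
        · intro d hd h
          simp [nonmonoPairs, h] at hd
        · refine (pow_le_pow_of_le_one q0.le q1
            (card_mul_card_le_nonmonoPairs i.2 i.1)).trans ?_
          refine pow_mul_le_of_balanced q0 q1 hN ?_ hi.2.1 hi.2.2 (hq _ hi.2.2)
          rw [Finset.card_filter_add_card_filter_not]
          simp
    _ ≤ ∑ i : (Bool × Bool) × (Fin N → Bool × Bool),
          M * (1 / N : ℝ) ^ (Finset.univ.filter fun v => i.2 v ≠ i.1).card :=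
        Finset.sum_le_sum_of_subset_of_nonneg (Finset.subset_univ _)
          fun i _ _ => by positivity
    _ = 4 * (M * (1 + 3 / N) ^ N) := by
        rw [Fintype.sum_prod_type]
        simp only [← Finset.mul_sum, sum_pow_card_ne]
        simp
        ring
    _ ≤ 4 * (M * Real.exp 3) := by
        gcongr
        calc (1 + 3 / N : ℝ) ^ N ≤ Real.exp (3 / N) ^ N := by
              gcongr
              linarith [Real.add_one_le_exp (3 / N : ℝ)]
          _ = Real.exp 3 := by
              rw [← Real.exp_nat_mul]
              congr 1
              field_simp

/-- The event that some vertex is isolated up to two neighbours. -/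
def nearlyIsolated (n : ℕ) : Set (Config n) :=
  {f | ∃ i ∈ (Finset.univ : Finset (Fin n × Fin n × Fin n)),
    f ∈ avoid (({i.1} ×ˢ {i.1, i.2.1, i.2.2}ᶜ) ∪ ({i.1, i.2.1, i.2.2}ᶜ ×ˢ {i.1}))}

lemma PrGnp_nearlyIsolated_le {n : ℕ} {p : ℝ} (h0 : 0 ≤ p) (h1 : p ≤ 1) :
    PrGnp n p (nearlyIsolated n) ≤ n ^ 3 * (1 - p) ^ (n - 3) := by
  calc _ ≤ ∑ i : Fin n × Fin n × Fin n, PrGnp n p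
          (avoid (({i.1} ×ˢ {i.1, i.2.1, i.2.2}ᶜ) ∪ ({i.1, i.2.1, i.2.2}ᶜ ×ˢ {i.1}))) :=
        prWeight_exists_le (configWeight_nonneg h0 h1) _ _
    _ ≤ ∑ i : Fin n × Fin n × Fin n, (1 - p) ^ (n - 3) := by
        refine Finset.sum_le_sum fun i _ => ?_
        refine (PrGnp_isolated_le h1 _ _ (by simp)).trans ?_
        refine pow_le_pow_of_le_one (by linarith) (by linarith) ?_
        rw [Finset.card_compl, Fintype.card_fin]
        have := Finset.card_le_three (a := i.1) (b := i.2.1) (c := i.2.2)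
        omega
    _ = n ^ 3 * (1 - p) ^ (n - 3) := by
        simp only [Finset.sum_const, Finset.card_univ, Fintype.card_prod, Fintype.card_fin,
          nsmul_eq_mul]
        push_cast
        ring

section Separation

variable {n : ℕ}

/-- The edges leaving `{s, b}`, together with the edge from `b` to `s`. -/
def outPairs (s b : Fin n) : Finset (Fin n × Fin n) :=
  ({b} ×ˢ {b}ᶜ) ∪ ({s} ×ˢ {s, b}ᶜ)

/-- The edges entering `{s, a}`, together with the edge from `s` to `a`. -/
def inPairs (s a : Fin n) : Finset (Fin n × Fin n) :=
  ({a}ᶜ ×ˢ {a}) ∪ ({s, a}ᶜ ×ˢ {s})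

/-- The edges entering `a` and the edges leaving `b`. -/
def inOutPairs (a b : Fin n) : Finset (Fin n × Fin n) :=
  ({a}ᶜ ×ˢ {a}) ∪ ({b} ×ˢ {a, b}ᶜ)

lemma mem_outPairs {s b u v : Fin n} :
    (u, v) ∈ outPairs s b ↔ (u = b ∧ v ≠ b) ∨ (u = s ∧ v ≠ s ∧ v ≠ b) := by
  simp only [outPairs, Finset.mem_union, Finset.mem_product, Finset.mem_singleton,
    Finset.mem_compl, Finset.mem_insert]
  grind

lemma mem_inPairs {s a u v : Fin n} :
    (u, v) ∈ inPairs s a ↔ (u ≠ a ∧ v = a) ∨ (u ≠ s ∧ u ≠ a ∧ v = s) := by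
  simp only [inPairs, Finset.mem_union, Finset.mem_product, Finset.mem_singleton,
    Finset.mem_compl, Finset.mem_insert]
  grind

lemma mem_inOutPairs {a b u v : Fin n} :
    (u, v) ∈ inOutPairs a b ↔ (u ≠ a ∧ v = a) ∨ (u = b ∧ v ≠ a ∧ v ≠ b) := by
  simp only [inOutPairs, Finset.mem_union, Finset.mem_product, Finset.mem_singleton,
    Finset.mem_compl, Finset.mem_insert]
  grind

lemma card_outPairs {s b : Fin n} (h : s ≠ b) : (outPairs s b).card = (n - 1) + (n - 2) := by
  rw [outPairs, Finset.card_union_of_disjoint]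
  · simp only [Finset.card_product, Finset.card_compl, Finset.card_pair h,
      Finset.card_singleton, Fintype.card_fin, one_mul]
  · rw [Finset.disjoint_left]
    rintro ⟨u, v⟩ hu hv
    simp at hu hv
    grind

lemma card_inPairs {s a : Fin n} (h : s ≠ a) : (inPairs s a).card = (n - 1) + (n - 2) := by
  rw [inPairs, Finset.card_union_of_disjoint]
  · simp only [Finset.card_product, Finset.card_compl, Finset.card_pair h,
      Finset.card_singleton, Fintype.card_fin, mul_one]
  · rw [Finset.disjoint_left]
    rintro ⟨u, v⟩ hu hv
    simp at hu hv
    grind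

lemma card_inOutPairs {a b : Fin n} (h : a ≠ b) :
    (inOutPairs a b).card = (n - 1) + (n - 2) := by
  rw [inOutPairs, Finset.card_union_of_disjoint]
  · simp only [Finset.card_product, Finset.card_compl, Finset.card_pair h,
      Finset.card_singleton, Fintype.card_fin, one_mul, mul_one]
  · rw [Finset.disjoint_left]
    rintro ⟨u, v⟩ hu hv
    simp at hu hv
    grind

lemma PrGnp_outPairs (p : ℝ) {s b : Fin n} (h : s ≠ b) :
    PrGnp n p (avoid (outPairs s b)) = (1 - p / 2) ^ ((n - 1) + (n - 2)) := by
  rw [← card_outPairs h]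
  refine PrGnp_avoid_eq p _ ?_ ?_ <;> rintro ⟨u, v⟩ hd <;>
    simp only [Prod.swap_prod_mk, mem_outPairs] at * <;> grind

lemma PrGnp_inPairs (p : ℝ) {s a : Fin n} (h : s ≠ a) :
    PrGnp n p (avoid (inPairs s a)) = (1 - p / 2) ^ ((n - 1) + (n - 2)) := by
  rw [← card_inPairs h]
  refine PrGnp_avoid_eq p _ ?_ ?_ <;> rintro ⟨u, v⟩ hd <;>
    simp only [Prod.swap_prod_mk, mem_inPairs] at * <;> grind

lemma PrGnp_inOutPairs (p : ℝ) {a b : Fin n} (h : a ≠ b) :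
    PrGnp n p (avoid (inOutPairs a b)) = (1 - p / 2) ^ ((n - 1) + (n - 2)) := by
  rw [← card_inOutPairs h]
  refine PrGnp_avoid_eq p _ ?_ ?_ <;> rintro ⟨u, v⟩ hd <;>
    simp only [Prod.swap_prod_mk, mem_inOutPairs] at * <;> grind

variable {s a b : Fin n}

lemma avoid_outPairs_subset (hsa : s ≠ a) (hsb : s ≠ b) (hab : a ≠ b) :
    avoid (outPairs s b) ⊆ {f | ¬ Reaches f s a ∧ ¬ Reaches f b s} := by
  intro f hf
  have hf' : ∀ u v, DirEdge f u v → (u, v) ∉ outPairs s b := fun u v h h' => hf _ h' h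
  simp only [mem_outPairs] at hf'
  constructor
  · refine not_reaches_of_closed {s, b} ?_ (by simp) (by simp [hsa.symm, hab])
    intro x hx y hxy
    have := hf' x y hxy
    simp only [Set.mem_insert_iff, Set.mem_singleton_iff] at hx ⊢
    grind
  · refine not_reaches_of_closed {b} ?_ (by simp) (by simp [hsb])
    intro x hx y hxy
    have := hf' x y hxy
    simp only [Set.mem_singleton_iff] at hx ⊢
    grind

lemma avoid_inPairs_subset (hsa : s ≠ a) (hsb : s ≠ b) (hab : a ≠ b) :
    avoid (inPairs s a) ⊆ {f | ¬ Reaches f s a ∧ ¬ Reaches f b s} := by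
  intro f hf
  have hf' : ∀ u v, DirEdge f u v → (u, v) ∉ inPairs s a := fun u v h h' => hf _ h' h
  simp only [mem_inPairs] at hf'
  constructor
  · refine not_reaches_of_closed {a}ᶜ ?_ (by simp [hsa]) (by simp)
    intro x hx y hxy
    have := hf' x y hxy
    simp only [Set.mem_compl_iff, Set.mem_singleton_iff] at hx ⊢
    grind
  · refine not_reaches_of_closed {s, a}ᶜ ?_ (by simp [hsb.symm, hab.symm]) (by simp)
    intro x hx y hxy
    have := hf' x y hxy
    simp only [Set.mem_compl_iff, Set.mem_insert_iff, Set.mem_singleton_iff] at hx ⊢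
    grind

lemma avoid_inOutPairs_subset (hsa : s ≠ a) (hsb : s ≠ b) (hab : a ≠ b) :
    avoid (inOutPairs a b) ⊆ {f | ¬ Reaches f s a ∧ ¬ Reaches f b s} := by
  intro f hf
  have hf' : ∀ u v, DirEdge f u v → (u, v) ∉ inOutPairs a b := fun u v h h' => hf _ h' h
  simp only [mem_inOutPairs] at hf'
  constructor
  · refine not_reaches_of_closed {a}ᶜ ?_ (by simp [hsa]) (by simp)
    intro x hx y hxy
    have := hf' x y hxy
    simp only [Set.mem_compl_iff, Set.mem_singleton_iff] at hx ⊢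
    grind
  · refine not_reaches_of_closed {b} ?_ (by simp) (by simp [hsb])
    intro x hx y hxy
    have := hf' x y hxy
    simp only [Set.mem_singleton_iff] at hx ⊢
    grind

lemma avoid_out_inter_in_subset :
    avoid (outPairs s b) ∩ avoid (inPairs s a) ⊆ nearlyIsolated n := by
  rw [avoid_inter]
  refine fun f hf => ⟨(s, a, b), Finset.mem_univ _, avoid_anti ?_ hf⟩
  rintro ⟨u, v⟩ h
  simp only [Finset.mem_union, Finset.mem_product, Finset.mem_singleton, Finset.mem_compl,
    Finset.mem_insert, mem_outPairs, mem_inPairs] at h ⊢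
  grind

/-- If `D` contains three disjoint families of pairs indexed by the vertices outside `{s, a, b}`,
then avoiding `D` has probability at most `(1 - p / 2) ^ (3 * (n - 3))`. -/
lemma PrGnp_avoid_le_of_three_stars {p : ℝ} (h0 : 0 ≤ p) (h1 : p ≤ 1)
    (D : Finset (Fin n × Fin n)) (hD : ∀ d ∈ D, d.1 ≠ d.2)
    (i₁ i₂ i₃ : Fin n → Fin n × Fin n)
    (hi₁ : i₁.Injective) (hi₂ : i₂.Injective) (hi₃ : i₃.Injective)
    (h₁₂ : ∀ v ∉ ({s, a, b} : Finset (Fin n)), ∀ w ∉ ({s, a, b} : Finset (Fin n)), i₁ v ≠ i₂ w)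
    (h₁₃ : ∀ v ∉ ({s, a, b} : Finset (Fin n)), ∀ w ∉ ({s, a, b} : Finset (Fin n)), i₁ v ≠ i₃ w)
    (h₂₃ : ∀ v ∉ ({s, a, b} : Finset (Fin n)), ∀ w ∉ ({s, a, b} : Finset (Fin n)), i₂ v ≠ i₃ w)
    (h : ∀ v ∉ ({s, a, b} : Finset (Fin n)), i₁ v ∈ D ∧ i₂ v ∈ D ∧ i₃ v ∈ D) :
    PrGnp n p (avoid D) ≤ (1 - p / 2) ^ (3 * (n - 3)) := by
  refine (PrGnp_avoid_le h0 h1 D hD).trans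
    (pow_le_pow_of_le_one (by linarith) (by linarith) ?_)
  set T : Finset (Fin n) := {s, a, b}ᶜ with hT
  have hmem : ∀ v ∈ T, v ∉ ({s, a, b} : Finset (Fin n)) := fun v hv => Finset.mem_compl.1 hv
  have hTc : n - 3 ≤ T.card := by
    rw [hT, Finset.card_compl, Fintype.card_fin]
    have := Finset.card_le_three (a := s) (b := a) (c := b)
    omega
  have d₁ : Disjoint (T.image i₁) (T.image i₂ ∪ T.image i₃) := by
    rw [Finset.disjoint_left]
    intro x hx hx'
    simp only [Finset.mem_union, Finset.mem_image] at hx hx'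
    obtain ⟨v, hv, rfl⟩ := hx
    rcases hx' with ⟨w, hw, e⟩ | ⟨w, hw, e⟩
    · exact h₁₂ v (hmem v hv) w (hmem w hw) e.symm
    · exact h₁₃ v (hmem v hv) w (hmem w hw) e.symm
  have d₂ : Disjoint (T.image i₂) (T.image i₃) := by
    rw [Finset.disjoint_left]
    intro x hx hx'
    simp only [Finset.mem_image] at hx hx'
    obtain ⟨v, hv, rfl⟩ := hx
    obtain ⟨w, hw, e⟩ := hx'
    exact h₂₃ v (hmem v hv) w (hmem w hw) e.symm
  have hsub : T.image i₁ ∪ (T.image i₂ ∪ T.image i₃) ⊆ D := by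
    intro x hx
    simp only [Finset.mem_union, Finset.mem_image] at hx
    rcases hx with ⟨v, hv, rfl⟩ | ⟨v, hv, rfl⟩ | ⟨v, hv, rfl⟩
    · exact (h v (hmem v hv)).1
    · exact (h v (hmem v hv)).2.1
    · exact (h v (hmem v hv)).2.2
  have := Finset.card_le_card hsub
  rw [Finset.card_union_of_disjoint d₁, Finset.card_union_of_disjoint d₂,
    Finset.card_image_of_injective _ hi₁, Finset.card_image_of_injective _ hi₂,
    Finset.card_image_of_injective _ hi₃] at this
  omega

lemma PrGnp_out_inter_inOut_le {p : ℝ} (h0 : 0 ≤ p) (h1 : p ≤ 1) (hsb : s ≠ b) :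
    PrGnp n p (avoid (outPairs s b) ∩ avoid (inOutPairs a b)) ≤ (1 - p / 2) ^ (3 * (n - 3)) := by
  rw [avoid_inter]
  refine PrGnp_avoid_le_of_three_stars (s := s) (a := a) (b := b) h0 h1 _ ?_
    (fun v => (s, v)) (fun v => (b, v)) (fun v => (v, a)) ?_ ?_ ?_ ?_ ?_ ?_ ?_
  · rintro ⟨u, v⟩ h
    simp only [Finset.mem_union, mem_outPairs, mem_inOutPairs] at h ⊢
    grind
  all_goals
    first
    | (intro v w h; grind)
    | (intro v hv
       simp only [Finset.mem_union, mem_outPairs, mem_inOutPairs, Finset.mem_insert,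
         Finset.mem_singleton] at hv ⊢
       grind)

lemma PrGnp_in_inter_inOut_le {p : ℝ} (h0 : 0 ≤ p) (h1 : p ≤ 1) (hsa : s ≠ a) :
    PrGnp n p (avoid (inPairs s a) ∩ avoid (inOutPairs a b)) ≤ (1 - p / 2) ^ (3 * (n - 3)) := by
  rw [avoid_inter]
  refine PrGnp_avoid_le_of_three_stars (s := s) (a := a) (b := b) h0 h1 _ ?_
    (fun v => (v, s)) (fun v => (v, a)) (fun v => (b, v)) ?_ ?_ ?_ ?_ ?_ ?_ ?_
  · rintro ⟨u, v⟩ h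
    simp only [Finset.mem_union, mem_inPairs, mem_inOutPairs] at h ⊢
    grind
  all_goals
    first
    | (intro v w h; grind)
    | (intro v hv
       simp only [Finset.mem_union, mem_inPairs, mem_inOutPairs, Finset.mem_insert,
         Finset.mem_singleton] at hv ⊢
       grind)

lemma exists_popular_color (c : Fin n → Bool × Bool) :
    ∃ γ, n ≤ 4 * (Finset.univ.filter fun v => c v = γ).card := by
  by_contra! h
  have h1 : ∑ γ : Bool × Bool, (Finset.univ.filter fun v => c v = γ).card = n := by
    have := Finset.card_eq_sum_card_fiberwise (f := c) (s := Finset.univ) (t := Finset.univ)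
      (fun _ _ => Finset.mem_coe.2 (Finset.mem_univ _))
    simpa using this.symm
  rw [Fintype.sum_prod_type] at h1
  simp only [Fintype.sum_bool] at h1
  have := h (true, true)
  have := h (true, false)
  have := h (false, true)
  have := h (false, false)
  omega

lemma not_reaches_subset (hsa : s ≠ a) (hsb : s ≠ b) (hab : a ≠ b) :
    {f : Config n | ¬ Reaches f s a ∧ ¬ Reaches f b s} ⊆
      avoid (outPairs s b) ∪ (avoid (inPairs s a) ∪ (avoid (inOutPairs a b) ∪
        (nearlyIsolated n ∪
          {f | ∃ i ∈ balancedColorings n, f ∈ avoid (nonmonoPairs i.2)}))) := by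
  classical
  rintro f ⟨hfa, hfb⟩
  set c : Fin n → Bool × Bool := fun v => (decide (Reaches f s v), decide (Reaches f b v))
    with hc
  have hmono : ∀ u v, DirEdge f u v → c u ≤ c v := by
    intro u v huv
    simp only [hc, Prod.mk_le_mk, Bool.le_iff_imp, decide_eq_true_eq]
    exact ⟨fun h => h.tail huv, fun h => h.tail huv⟩
  have hcs : c s = (true, false) := by
    simp only [hc, Prod.mk.injEq, decide_eq_true_eq, decide_eq_false_iff_not]
    exact ⟨.refl, hfb⟩
  have hcb : (c b).2 = true := by
    simp only [hc, decide_eq_true_eq]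
    exact .refl
  have hca : (c a).1 = false := by
    simpa only [hc, decide_eq_false_iff_not] using hfa
  clear_value c
  obtain ⟨γ, hγ⟩ := exists_popular_color c
  by_cases hk : 3 ≤ (Finset.univ.filter fun v => c v ≠ γ).card
  · refine .inr (.inr (.inr (.inr ⟨(γ, c), ?_, ?_⟩)))
    · simp only [balancedColorings, Finset.mem_filter, Finset.mem_univ, true_and]
      exact ⟨hk, hγ⟩
    · rintro ⟨u, v⟩ h huv
      simp only [nonmonoPairs, Finset.mem_filter] at h
      exact h.2 (hmono u v huv)
  have hrest : ∀ x y, x ≠ y → c x ≠ γ → c y ≠ γ → ∀ v, v ≠ x → v ≠ y → c v = γ := by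
    intro x y hxy hx hy v hvx hvy
    by_contra hv
    refine hk ?_
    rw [← Finset.card_eq_three.2 ⟨x, y, v, hxy, hvx.symm, hvy.symm, rfl⟩]
    refine Finset.card_le_card fun w hw => ?_
    simp only [Finset.mem_insert, Finset.mem_singleton] at hw
    simp only [Finset.mem_filter, Finset.mem_univ, true_and]
    rcases hw with rfl | rfl | rfl <;> assumption
  have hisolated : ∀ u x y, (∀ v, v ≠ u → v ≠ x → v ≠ y → ¬ c u ≤ c v ∧ ¬ c v ≤ c u) →
      f ∈ nearlyIsolated n := by
    refine fun u x y h => ⟨(u, x, y), Finset.mem_univ _, ?_⟩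
    rintro ⟨v, w⟩ hd hvw
    have := hmono v w hvw
    simp only [Finset.mem_union, Finset.mem_product, Finset.mem_singleton, Finset.mem_compl,
      Finset.mem_insert, not_or] at hd
    rcases hd with ⟨rfl, h₁, h₂, h₃⟩ | ⟨⟨h₁, h₂, h₃⟩, rfl⟩
    · exact (h w h₁ h₂ h₃).1 this
    · exact (h v h₁ h₂ h₃).2 this
  have htf : ¬ ((true, false) : Bool × Bool) ≤ (false, true) := by decide
  have hft : ¬ ((false, true) : Bool × Bool) ≤ (true, false) := by decide
  simp only [Prod.le_def, Bool.le_iff_imp] at hmono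
  obtain ⟨_ | _, _ | _⟩ := γ
  · refine .inl ?_
    have hr := hrest s b hsb (by simp [hcs]) (by grind)
    rintro ⟨u, v⟩ hd huv
    have := hmono u v huv
    rw [mem_outPairs] at hd
    grind
  · refine .inr (.inr (.inr (.inl ?_)))
    have hs : c s ≠ (false, true) := by simp [hcs]
    by_cases hx : ∃ x, s ≠ x ∧ c x ≠ (false, true)
    · obtain ⟨x, hsx, hx⟩ := hx
      refine hisolated s x x fun v h₁ h₂ _ => ?_
      rw [hrest s x hsx hs hx v h₁ h₂, hcs]
      exact ⟨htf, hft⟩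
    · push Not at hx
      refine hisolated s s s fun v h₁ _ _ => ?_
      rw [hx v h₁.symm, hcs]
      exact ⟨htf, hft⟩
  · have hr := hrest a b hab (by grind) (by grind)
    by_cases hb : c b = (false, true)
    · refine .inr (.inr (.inr (.inl (hisolated b a a fun v h₁ h₂ _ => ?_))))
      rw [hr v h₂ h₁, hb]
      exact ⟨hft, htf⟩
    by_cases ha : c a = (false, true)
    · refine .inr (.inr (.inr (.inl (hisolated a b b fun v h₁ h₂ _ => ?_))))
      rw [hr v h₁ h₂, ha]
      exact ⟨hft, htf⟩
    refine .inr (.inr (.inl ?_))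
    have hb1 : (c b).1 = true := by
      by_contra h
      exact hb (Prod.ext (by simpa using h) hcb)
    rintro ⟨u, v⟩ hd huv
    have := hmono u v huv
    rw [mem_inOutPairs] at hd
    grind
  · refine .inr (.inl ?_)
    have hr := hrest s a hsa (by simp [hcs]) (by grind)
    rintro ⟨u, v⟩ hd huv
    have := hmono u v huv
    rw [mem_inPairs] at hd
    grind

end Separation

lemma abs_PrGnp_not_reaches_sub_le {N : ℕ} {p : ℝ} (h0 : 0 ≤ p) (h1 : p ≤ 1) (hN : 1 ≤ N)
    (hq : ∀ m, N ≤ 4 * m → N * (1 - p / 2) ^ m ≤ 1) {s a b : Fin N}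
    (hsa : s ≠ a) (hsb : s ≠ b) (hab : a ≠ b) :
    |PrGnp N p {f | ¬ Reaches f s a ∧ ¬ Reaches f b s} -
        3 * (1 - p / 2) ^ ((N - 1) + (N - 2))| ≤
      N ^ 3 * (1 - p) ^ (N - 3) + 2 * (1 - p / 2) ^ (3 * (N - 3)) +
        4 * (N ^ 12 * (1 - p / 2) ^ (3 * N) / (1 - p / 2) ^ 36 * Real.exp 3) := by
  have hw := configWeight_nonneg (n := N) h0 h1
  have q0 : 0 < 1 - p / 2 := by linarith
  have e₁ := PrGnp_outPairs p hsb
  have e₂ := PrGnp_inPairs p hsa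
  have e₃ := PrGnp_inOutPairs p hab
  have i₁ := (prWeight_mono hw (avoid_out_inter_in_subset (s := s) (a := a) (b := b))).trans
    (PrGnp_nearlyIsolated_le h0 h1)
  have i₂ := PrGnp_out_inter_inOut_le (a := a) h0 h1 hsb
  have i₃ := PrGnp_in_inter_inOut_le (b := b) h0 h1 hsa
  have lower := prWeight_bonferroni hw (avoid_outPairs_subset hsa hsb hab)
    (avoid_inPairs_subset hsa hsb hab) (avoid_inOutPairs_subset hsa hsb hab)
  have u₀ := prWeight_mono hw (not_reaches_subset hsa hsb hab)
  have u₁ := u₀.trans (prWeight_union_le hw _ _)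
  have u₂ := u₁.trans (add_le_add le_rfl (prWeight_union_le hw _ _))
  have u₃ := u₂.trans (add_le_add le_rfl (add_le_add le_rfl (prWeight_union_le hw _ _)))
  have u₄ := u₃.trans (add_le_add le_rfl (add_le_add le_rfl
    (add_le_add le_rfl (prWeight_union_le hw _ _))))
  have g₁ := PrGnp_nearlyIsolated_le (n := N) h0 h1
  have g₂ := PrGnp_balanced_le h0 h1 hN hq
  have p₁ : 0 ≤ (1 - p / 2) ^ (3 * (N - 3)) := by positivity
  have p₂ : 0 ≤ 4 * (N ^ 12 * (1 - p / 2) ^ (3 * N) / (1 - p / 2) ^ 36 * Real.exp 3) := by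
    positivity
  unfold PrGnp at *
  rw [abs_le]
  constructor <;> linarith

lemma eventually_mul_pow_le_one {q : ℝ} (h0 : 0 < q) (h1 : q < 1) :
    ∀ᶠ N : ℕ in atTop, ∀ m, N ≤ 4 * m → N * q ^ m ≤ 1 := by
  have h := (tendsto_self_mul_const_pow_of_lt_one h0.le h1).const_mul 4
  rw [mul_zero] at h
  obtain ⟨M, hM⟩ := eventually_atTop.1 (h.eventually_le_const zero_lt_one)
  filter_upwards [eventually_ge_atTop (4 * M)] with N hN m hm
  calc (N : ℝ) * q ^ m ≤ (4 * m) * q ^ m := by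
        gcongr
        exact_mod_cast hm
    _ ≤ 1 := by simpa [mul_assoc] using hM m (by omega)

lemma tendsto_add_three_pow_mul_pow (k : ℕ) {r : ℝ} (h0 : 0 ≤ r) (h1 : r < 1) :
    Tendsto (fun n : ℕ => ((n + 3 : ℕ) : ℝ) ^ k * r ^ n) atTop (nhds 0) := by
  have h := (tendsto_pow_const_mul_const_pow_of_lt_one k h0 h1).const_mul (4 ^ k)
  rw [mul_zero] at h
  refine squeeze_zero' (Eventually.of_forall fun n => by positivity) ?_ h
  filter_upwards [eventually_ge_atTop 1] with n hn
  rw [← mul_assoc, ← mul_pow]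
  gcongr
  exact_mod_cast (by omega : n + 3 ≤ 4 * n)

/-- Fix `p ∈ (0,1]` and distinct vertices `s, a, b` of `⃗G(n,p)`
(graphs on `n + 3` vertices). Then
`P(s ↛ a and b ↛ s) = 3 (1-p/2)^(2n-3) + o((1-p/2)^(2n))` as `n → ∞`. -/
theorem gnp_joint_not_reach_asymp
    (p : ℝ) (hp : p ∈ Set.Ioc (0 : ℝ) 1)
    (s a b : (n : ℕ) → Fin (n + 3))
    (hsa : ∀ n, s n ≠ a n) (hsb : ∀ n, s n ≠ b n) (hab : ∀ n, a n ≠ b n) :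
    Filter.Tendsto (fun n : ℕ =>
        (PrGnp (n + 3) p {f | ¬ Reaches f (s n) (a n) ∧ ¬ Reaches f (b n) (s n)} -
            3 * (1 - p / 2) ^ (2 * (n + 3) - 3)) /
          (1 - p / 2) ^ (2 * (n + 3)))
      Filter.atTop (nhds 0) := by
  obtain ⟨hp0, hp1⟩ := hp
  set q := 1 - p / 2 with hq
  have q0 : 0 < q := by linarith
  have q1 : q < 1 := by linarith
  set r := (1 - p) / q ^ 2 with hr
  have r0 : 0 ≤ r := div_nonneg (by linarith) (by positivity)
  have r1 : r < 1 := by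
    rw [hr, div_lt_one (by positivity), hq]
    nlinarith
  have hlim : Tendsto (fun n : ℕ => ((n + 3 : ℕ) : ℝ) ^ 3 * r ^ n / q ^ 6 + 2 * q ^ n / q ^ 6 +
      4 * Real.exp 3 / q ^ 33 * (((n + 3 : ℕ) : ℝ) ^ 12 * q ^ n)) atTop (nhds 0) := by
    have l₁ := (tendsto_add_three_pow_mul_pow 3 r0 r1).div_const (q ^ 6)
    have l₂ := ((tendsto_pow_atTop_nhds_zero_of_lt_one q0.le q1).const_mul 2).div_const (q ^ 6)
    have l₃ := (tendsto_add_three_pow_mul_pow 12 q0.le q1).const_mul (4 * Real.exp 3 / q ^ 33)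
    simpa using (l₁.add l₂).add l₃
  refine squeeze_zero_norm' ?_ hlim
  filter_upwards [(tendsto_add_atTop_nat 3).eventually (eventually_mul_pow_le_one q0 q1)]
    with n hn
  have key := abs_PrGnp_not_reaches_sub_le hp0.le hp1 (by omega) hn (hsa n) (hsb n) (hab n)
  rw [← hq, show n + 3 - 1 + (n + 3 - 2) = 2 * (n + 3) - 3 by omega,
    show n + 3 - 3 = n by omega] at key
  rw [Real.norm_eq_abs, abs_div, abs_of_pos (pow_pos q0 (2 * (n + 3))),
    div_le_iff₀ (by positivity)]
  refine key.trans_eq ?_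
  have hpr : 1 - p = r * q ^ 2 := by
    rw [hr]
    field_simp
  rw [hpr, mul_pow]
  field_simp
  ring_nf
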